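/- arXiv:math/0702298 — 2 statements merged into one kernel-verified Lean document; each statement's English description precedes it below -/
import Mathlib

section
/- Let r, s, r', s' be nonzero complex numbers with r s^{−1} = r' s'^{−1}. Define ψ : Q × Q → ℂˣ by ψ(μ,ν) = (r^{−1}r')^{⟨μ,ν⟩}; then ψ is a 2-cocycle (indeed a bicharacter) of the abelian group Q, and there is an isomorphism of Q⁺-graded ℂ-algebras from U⁺_{r,s} onto the cocycle deformation (U⁺_{r',s'})^ψ (same underlying graded vector space as U⁺_{r',s'}, with new product x * y = ψ(μ,ν) x y for x of degree μ and y of degree ν) sending e_i to e_i for every i ∈ I. In particular U⁺_{r,s} and U⁺_{r',s'} are 2-cocycle deformations of each other. -/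
noncomputable section

/-- The q-integer `(m)_v = 1 + v + ⋯ + v^{m-1}`. -/
def qnat {K : Type} [CommRing K] (v : K) (m : ℕ) : K := ∑ i ∈ Finset.range m, v ^ i

/-- The Gaussian binomial coefficient `binom(m,k)_v`, as a polynomial expression in `v`
(defined through the Pascal-type recurrence). -/
def qbinom {K : Type} [CommRing K] (v : K) : ℕ → ℕ → K
  | _, 0 => 1
  | 0, _ + 1 => 0
  | m + 1, k + 1 => qbinom v m k + v ^ (k + 1) * qbinom v m (k + 1)

/-- The Euler (Ringel) form on basis elements: `⟨α_i, α_j⟩ = d_i a_{ij}` if `i < j`,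
`d_i` if `i = j`, and `0` if `i > j`. -/
def eulB {n : ℕ} (a : Fin n → Fin n → ℤ) (d : Fin n → ℤ) (i j : Fin n) : ℤ :=
  if i < j then d i * a i j else if i = j then d i else 0

/-- The Euler form on the root lattice `Q = Fin n → ℤ` (coordinates in the basis `α_i`). -/
def euler {n : ℕ} (a : Fin n → Fin n → ℤ) (d : Fin n → ℤ) (μ ν : Fin n → ℤ) : ℤ :=
  ∑ i, ∑ j, μ i * ν j * eulB a d i j

/-- The coefficient `c^{(k)}_{ij} = (r_i s_i⁻¹)^{k(k-1)/2} r^{k⟨α_j,α_i⟩} s^{-k⟨α_i,α_j⟩}`. -/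
def ccoef {K : Type} [Field K] {n : ℕ} (a : Fin n → Fin n → ℤ) (d : Fin n → ℤ)
    (r s : K) (i j : Fin n) (k : ℕ) : K :=
  (r ^ d i * (s ^ d i)⁻¹) ^ (k * (k - 1) / 2) *
    r ^ ((k : ℤ) * eulB a d j i) * (s ^ ((k : ℤ) * eulB a d i j))⁻¹

/-- The `(r,s)`-Serre element
`∑_{k=0}^{1-a_{ij}} (-1)^k binom(1-a_{ij},k)_{r_i s_i⁻¹} c^{(k)}_{ij} E_i^{1-a_{ij}-k} E_j E_i^k`. -/
def serreElt {K : Type} [Field K] {n : ℕ} (a : Fin n → Fin n → ℤ) (d : Fin n → ℤ)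
    (r s : K) {A : Type} [Ring A] [Algebra K A] (E : Fin n → A) (i j : Fin n) : A :=
  ∑ k ∈ Finset.range ((1 - a i j).toNat + 1),
    ((-1 : K) ^ k * qbinom (r ^ d i * (s ^ d i)⁻¹) ((1 - a i j).toNat) k *
        ccoef a d r s i j k) •
      (E i ^ ((1 - a i j).toNat - k) * E j * E i ^ k)

/-- The defining relations of `U⁺_{r,s}`: the `(r,s)`-Serre relations. -/
inductive SerreRel (K : Type) [Field K] {n : ℕ} (a : Fin n → Fin n → ℤ) (d : Fin n → ℤ)
    (r s : K) : FreeAlgebra K (Fin n) → FreeAlgebra K (Fin n) → Prop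
  | rel (i j : Fin n) (h : i ≠ j) :
      SerreRel K a d r s (serreElt a d r s (FreeAlgebra.ι K) i j) 0

/-- `U⁺_{r,s}`: the algebra generated by the `e_i` subject only to the `(r,s)`-Serre
relations. -/
abbrev Uplus (K : Type) [Field K] {n : ℕ} (a : Fin n → Fin n → ℤ) (d : Fin n → ℤ)
    (r s : K) : Type := RingQuot (SerreRel K a d r s)

/-- The generator `e_i` of `U⁺_{r,s}`. -/
def eP (K : Type) [Field K] {n : ℕ} (a : Fin n → Fin n → ℤ) (d : Fin n → ℤ)
    (r s : K) (i : Fin n) : Uplus K a d r s :=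
  RingQuot.mkAlgHom K (SerreRel K a d r s) (FreeAlgebra.ι K i)

/-- The degree-`μ` homogeneous component of `U⁺_{r,s}` for `μ ∈ Q⁺`: the span of the
monomials in the `e_i` in which `e_i` occurs exactly `μ i` times. -/
def UplusDeg (K : Type) [Field K] {n : ℕ} (a : Fin n → Fin n → ℤ) (d : Fin n → ℤ)
    (r s : K) (μ : Fin n → ℕ) : Submodule K (Uplus K a d r s) :=
  Submodule.span K
    {x | ∃ w : List (Fin n), (∀ i, w.count i = μ i) ∧ x = (w.map (eP K a d r s)).prod}


section EulerForm

variable {n : ℕ} (a : Fin n → Fin n → ℤ) (d : Fin n → ℤ)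

theorem euler_add_left (μ μ' ν : Fin n → ℤ) :
    euler a d (μ + μ') ν = euler a d μ ν + euler a d μ' ν := by
  simp only [euler, ← Finset.sum_add_distrib, Pi.add_apply, add_mul]

theorem euler_add_right (μ ν ν' : Fin n → ℤ) :
    euler a d μ (ν + ν') = euler a d μ ν + euler a d μ ν' := by
  simp only [euler, ← Finset.sum_add_distrib, Pi.add_apply, add_mul, mul_add]

theorem euler_smul_left (c : ℤ) (μ ν : Fin n → ℤ) :
    euler a d (c • μ) ν = c * euler a d μ ν := by
  simp only [euler, Finset.mul_sum, Pi.smul_apply, smul_eq_mul, mul_assoc]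

theorem euler_smul_right (c : ℤ) (μ ν : Fin n → ℤ) :
    euler a d μ (c • ν) = c * euler a d μ ν := by
  simp only [euler, Finset.mul_sum, Pi.smul_apply, smul_eq_mul]
  exact Finset.sum_congr rfl fun _ _ => Finset.sum_congr rfl fun _ _ => by ring

@[simp]
theorem euler_zero_left (ν : Fin n → ℤ) : euler a d 0 ν = 0 := by simp [euler]

@[simp]
theorem euler_zero_right (μ : Fin n → ℤ) : euler a d μ 0 = 0 := by simp [euler]

@[simp]
theorem euler_single_single (i j : Fin n) :
    euler a d (Pi.single i 1) (Pi.single j 1) = eulB a d i j := by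
  simp [euler, Pi.single_apply]

/-- The weight of a word in the index set, as an element of the root lattice. -/
def wordWeight (w : List (Fin n)) : Fin n → ℤ := fun i => w.count i

@[simp]
theorem wordWeight_nil : wordWeight ([] : List (Fin n)) = 0 := by
  ext i; simp [wordWeight]

theorem wordWeight_append (u w : List (Fin n)) :
    wordWeight (u ++ w) = wordWeight u + wordWeight w := by
  ext i; simp [wordWeight]

theorem wordWeight_cons (i : Fin n) (w : List (Fin n)) :
    wordWeight (i :: w) = Pi.single i 1 + wordWeight w := by
  ext j
  by_cases h : j = i
  · subst h; simp [wordWeight, add_comm]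
  · simp [wordWeight, h, Ne.symm h]

theorem wordWeight_replicate (m : ℕ) (i : Fin n) :
    wordWeight (List.replicate m i) = (m : ℤ) • Pi.single i 1 := by
  ext j
  by_cases h : j = i
  · subst h; simp [wordWeight]
  · simp [wordWeight, h, List.count_replicate, Ne.symm h]

/-- The sum of `⟨α_x, α_y⟩` over all pairs of letters `x`, `y` with `x` before `y`: the exponent
relating the twisted and the untwisted product of a word. -/
def twistExp : List (Fin n) → ℤ
  | [] => 0
  | i :: w => euler a d (Pi.single i 1) (wordWeight w) + twistExp w

theorem twistExp_append (u w : List (Fin n)) :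
    twistExp a d (u ++ w) =
      twistExp a d u + twistExp a d w + euler a d (wordWeight u) (wordWeight w) := by
  induction u with
  | nil => simp [twistExp]
  | cons i u ih =>
    simp only [List.cons_append, twistExp, ih, wordWeight_append, wordWeight_cons,
      euler_add_left, euler_add_right]
    ring

/-- The word `i^{m-k} j i^k` occurring in the Serre relations. -/
def serreWord (m : ℕ) (i j : Fin n) (k : ℕ) : List (Fin n) :=
  List.replicate (m - k) i ++ j :: List.replicate k i

theorem wordWeight_serreWord {m k : ℕ} (hk : k ≤ m) (i j : Fin n) :
    wordWeight (serreWord m i j k) = (m : ℤ) • Pi.single i 1 + Pi.single j 1 := by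
  rw [serreWord, wordWeight_append, wordWeight_cons, wordWeight_replicate, wordWeight_replicate,
    Nat.cast_sub hk, sub_smul]
  abel

theorem twistExp_serreWord {m k : ℕ} (hk : k ≤ m) (i j : Fin n) :
    twistExp a d (serreWord m i j k) =
      twistExp a d (List.replicate m i) + m * eulB a d i j +
        k * (eulB a d j i - eulB a d i j) := by
  have h : List.replicate m i = List.replicate (m - k) i ++ List.replicate k i := by
    rw [← List.replicate_add, Nat.sub_add_cancel hk]
  rw [h, serreWord, twistExp_append, twistExp_append]
  simp only [twistExp, wordWeight_cons, wordWeight_replicate, euler_add_right, euler_smul_left,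
    euler_smul_right, euler_single_single, Nat.cast_sub hk]
  ring

end EulerForm

section Serre

variable {K : Type} [Field K] {n : ℕ} (a : Fin n → Fin n → ℤ) (d : Fin n → ℤ)

/-- The coefficient of `E_i^{1-a_{ij}-k} E_j E_i^k` in the `(r,s)`-Serre element. -/
def serreCoef (r s : K) (i j : Fin n) (k : ℕ) : K :=
  (-1 : K) ^ k * qbinom (r ^ d i * (s ^ d i)⁻¹) ((1 - a i j).toNat) k * ccoef a d r s i j k

theorem serreElt_eq_sum_serreWord (r s : K) {A : Type} [Ring A] [Algebra K A] (E : Fin n → A)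
    (i j : Fin n) :
    serreElt a d r s E i j = ∑ k ∈ Finset.range ((1 - a i j).toNat + 1),
      serreCoef a d r s i j k • ((serreWord (1 - a i j).toNat i j k).map E).prod := by
  simp [serreElt, serreCoef, serreWord, mul_assoc]

theorem map_serreElt (r s : K) {A B : Type} [Ring A] [Algebra K A] [Ring B] [Algebra K B]
    (f : A →ₐ[K] B) (E : Fin n → A) (i j : Fin n) :
    f (serreElt a d r s E i j) = serreElt a d r s (fun i => f (E i)) i j := by
  simp [serreElt]

theorem serreElt_smul (r s : K) {A : Type} [Ring A] [Algebra K A] (c : Fin n → K)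
    (E : Fin n → A) (i j : Fin n) :
    serreElt a d r s (fun i => c i • E i) i j =
      (c i ^ (1 - a i j).toNat * c j) • serreElt a d r s E i j := by
  rw [serreElt, serreElt, Finset.smul_sum]
  refine Finset.sum_congr rfl fun k hk => ?_
  have hk : k ≤ (1 - a i j).toNat := Nat.lt_succ_iff.mp (Finset.mem_range.mp hk)
  simp only [smul_pow, smul_mul_assoc, mul_smul_comm, smul_smul]
  congr 1
  rw [← pow_sub_mul_pow (c i) hk]
  ring

theorem serreCoef_mul_zpow {r s r' s' : K} (hr : r ≠ 0) (hs : s ≠ 0) (hr' : r' ≠ 0)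
    (hs' : s' ≠ 0) (hpar : r * s⁻¹ = r' * s'⁻¹) (i j : Fin n) (k : ℕ) :
    serreCoef a d r s i j k * (r⁻¹ * r') ^ ((k : ℤ) * (eulB a d j i - eulB a d i j)) =
      serreCoef a d r' s' i j k := by
  have hv : r ^ d i * (s ^ d i)⁻¹ = r' ^ d i * (s' ^ d i)⁻¹ := by
    rw [← inv_zpow, ← inv_zpow, ← mul_zpow, ← mul_zpow, hpar]
  have hs'_eq : s' = s * (r⁻¹ * r') := by
    field_simp at hpar ⊢
    linear_combination hpar
  have ht : r⁻¹ * r' ≠ 0 := mul_ne_zero (inv_ne_zero hr) hr'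
  have hr'_eq : r' = r * (r⁻¹ * r') := by field_simp
  rw [serreCoef, serreCoef, ccoef, ccoef, ← hv, hs'_eq]
  generalize r⁻¹ * r' = t at *
  subst hr'_eq
  rw [mul_zpow, mul_zpow, mul_inv, mul_sub, zpow_sub₀ ht, div_eq_mul_inv]
  ring

end Serre

section Uplus

variable {K : Type} [Field K] {n : ℕ} (a : Fin n → Fin n → ℤ) (d : Fin n → ℤ)

/-- The monomial `e_{w_1} ⋯ e_{w_l}` in `U⁺_{r,s}`. -/
def uplusWord (r s : K) (w : List (Fin n)) : Uplus K a d r s := (w.map (eP K a d r s)).prod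

theorem uplusWord_cons (r s : K) (i : Fin n) (w : List (Fin n)) :
    uplusWord a d r s (i :: w) = eP K a d r s i * uplusWord a d r s w := by
  simp [uplusWord]

theorem uplusWord_append (r s : K) (u w : List (Fin n)) :
    uplusWord a d r s (u ++ w) = uplusWord a d r s u * uplusWord a d r s w := by
  simp [uplusWord]

theorem span_range_uplusWord (r s : K) :
    Submodule.span K (Set.range (uplusWord a d r s)) = ⊤ := by
  rw [eq_top_iff]
  rintro x -
  obtain ⟨y, rfl⟩ := RingQuot.mkAlgHom_surjective K (SerreRel K a d r s) x
  have hone : (1 : Uplus K a d r s) ∈ Submodule.span K (Set.range (uplusWord a d r s)) :=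
    Submodule.subset_span ⟨[], rfl⟩
  induction y using FreeAlgebra.induction with
  | grade0 c =>
    rw [AlgHom.commutes, Algebra.algebraMap_eq_smul_one]
    exact Submodule.smul_mem _ c hone
  | grade1 i => exact Submodule.subset_span ⟨[i], by simp [uplusWord, eP]⟩
  | add y z hy hz => rw [map_add]; exact add_mem hy hz
  | mul y z hy hz =>
    rw [map_mul]
    have h := Submodule.mul_mem_mul hy hz
    rw [Submodule.span_mul_span] at h
    refine Submodule.span_mono ?_ h
    rintro _ ⟨_, ⟨u, rfl⟩, _, ⟨w, rfl⟩, rfl⟩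
    exact ⟨u ++ w, uplusWord_append a d r s u w⟩

theorem serreElt_eP (r s : K) {i j : Fin n} (h : i ≠ j) :
    serreElt a d r s (eP K a d r s) i j = 0 := by
  have := RingQuot.mkAlgHom_rel K (SerreRel.rel (K := K) (a := a) (d := d) (r := r) (s := s) i j h)
  rwa [map_serreElt, map_zero] at this

/-- The universal property of `U⁺_{r,s}`. -/
def uplusLift (r s : K) {A : Type} [Ring A] [Algebra K A] (E : Fin n → A)
    (h : ∀ i j, i ≠ j → serreElt a d r s E i j = 0) : Uplus K a d r s →ₐ[K] A :=
  RingQuot.liftAlgHom K ⟨FreeAlgebra.lift K E, by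
    rintro _ _ ⟨i, j, hij⟩
    simp only [map_serreElt, FreeAlgebra.lift_ι_apply, map_zero]
    exact h i j hij⟩

theorem uplusLift_eP (r s : K) {A : Type} [Ring A] [Algebra K A] (E : Fin n → A)
    (h : ∀ i j, i ≠ j → serreElt a d r s E i j = 0) (i : Fin n) :
    uplusLift a d r s E h (eP K a d r s i) = E i := by
  simp [uplusLift, eP]

theorem uplusLift_uplusWord (r s : K) {A : Type} [Ring A] [Algebra K A] (E : Fin n → A)
    (h : ∀ i j, i ≠ j → serreElt a d r s E i j = 0) (w : List (Fin n)) :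
    uplusLift a d r s E h (uplusWord a d r s w) = (w.map E).prod := by
  simp [uplusWord, map_list_prod, Function.comp_def, uplusLift_eP]

/-- The algebra endomorphism of `U⁺_{r,s}` multiplying each `e_j` by `c j`. -/
def uplusScale (r s : K) (c : Fin n → K) : Uplus K a d r s →ₐ[K] Uplus K a d r s :=
  uplusLift a d r s (fun j => c j • eP K a d r s j) fun i j h => by
    rw [serreElt_smul, serreElt_eP a d r s h, smul_zero]

theorem uplusScale_uplusWord (r s : K) {t : K} (ht : t ≠ 0) (μ : Fin n → ℤ) (w : List (Fin n)) :
    uplusScale a d r s (fun j => t ^ euler a d μ (Pi.single j 1)) (uplusWord a d r s w) =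
      t ^ euler a d μ (wordWeight w) • uplusWord a d r s w := by
  induction w with
  | nil => simp [uplusWord]
  | cons j w ih =>
    rw [uplusWord_cons, map_mul, ih, uplusScale, uplusLift_eP, wordWeight_cons, euler_add_right,
      zpow_add₀ ht, smul_mul_smul_comm]

/-- Left multiplication by `e_i` for the product of `U⁺_{r,s}` twisted by the bicharacter
`t^{⟨μ,ν⟩}`. -/
def twistedMulLeft (r s t : K) (i : Fin n) : Module.End K (Uplus K a d r s) :=
  LinearMap.mulLeft K (eP K a d r s i) ∘ₗ
    (uplusScale a d r s fun j => t ^ euler a d (Pi.single i 1) (Pi.single j 1)).toLinearMap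

theorem prod_twistedMulLeft_uplusWord (r s : K) {t : K} (ht : t ≠ 0) (u w : List (Fin n)) :
    (u.map (twistedMulLeft a d r s t)).prod (t ^ twistExp a d w • uplusWord a d r s w) =
      t ^ twistExp a d (u ++ w) • uplusWord a d r s (u ++ w) := by
  induction u with
  | nil => simp
  | cons i u ih =>
    rw [List.map_cons, List.prod_cons, Module.End.mul_apply, ih, map_smul, twistedMulLeft,
      LinearMap.comp_apply, AlgHom.toLinearMap_apply, uplusScale_uplusWord a d r s ht, map_smul,
      LinearMap.mulLeft_apply, ← uplusWord_cons, smul_smul, ← zpow_add₀ ht, List.cons_append,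
      twistExp, add_comm]

theorem serreElt_twistedMulLeft {r s r' s' : K} (hr : r ≠ 0) (hs : s ≠ 0) (hr' : r' ≠ 0)
    (hs' : s' ≠ 0) (hpar : r * s⁻¹ = r' * s'⁻¹) {i j : Fin n} (hij : i ≠ j) :
    serreElt a d r s (twistedMulLeft a d r' s' (r⁻¹ * r')) i j = 0 := by
  have ht : r⁻¹ * r' ≠ 0 := mul_ne_zero (inv_ne_zero hr) hr'
  refine LinearMap.ext_on_range (span_range_uplusWord a d r' s') fun w => ?_
  set t := r⁻¹ * r' with t_def
  set m := (1 - a i j).toNat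
  have hsum : serreElt a d r' s' (eP K a d r' s') i j * uplusWord a d r' s' w = 0 := by
    rw [serreElt_eP a d r' s' hij, zero_mul]
  rw [serreElt_eq_sum_serreWord, Finset.sum_mul] at hsum
  refine (smul_eq_zero_iff_right (zpow_ne_zero (twistExp a d w) ht)).mp ?_
  rw [← map_smul, serreElt_eq_sum_serreWord, LinearMap.sum_apply, ← smul_zero (t ^ (twistExp a d w +
    (twistExp a d (List.replicate m i) + m * eulB a d i j) +
    euler a d ((m : ℤ) • Pi.single i 1 + Pi.single j 1) (wordWeight w))), ← hsum, Finset.smul_sum]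
  refine Finset.sum_congr rfl fun k hk => ?_
  have hk : k ≤ m := Nat.lt_succ_iff.mp (Finset.mem_range.mp hk)
  rw [LinearMap.smul_apply, prod_twistedMulLeft_uplusWord a d r' s' ht, uplusWord_append,
    ← serreCoef_mul_zpow a d hr hs hr' hs' hpar, smul_mul_assoc, smul_smul, smul_smul,
    twistExp_append, wordWeight_serreWord hk, twistExp_serreWord a d hk, ← t_def]
  congr 1
  simp only [zpow_add₀ ht]
  ring

/-- The linear map `U⁺_{r,s} → U⁺_{r',s'}` underlying the cocycle deformation. -/
def uplusTwist {r s r' s' : K} (hr : r ≠ 0) (hs : s ≠ 0) (hr' : r' ≠ 0)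
    (hs' : s' ≠ 0) (hpar : r * s⁻¹ = r' * s'⁻¹) : Uplus K a d r s →ₗ[K] Uplus K a d r' s' :=
  LinearMap.applyₗ (1 : Uplus K a d r' s') ∘ₗ
    (uplusLift a d r s (twistedMulLeft a d r' s' (r⁻¹ * r')) fun _ _ h =>
      serreElt_twistedMulLeft a d hr hs hr' hs' hpar h).toLinearMap

theorem uplusTwist_uplusWord {r s r' s' : K} (hr : r ≠ 0) (hs : s ≠ 0) (hr' : r' ≠ 0)
    (hs' : s' ≠ 0) (hpar : r * s⁻¹ = r' * s'⁻¹) (w : List (Fin n)) :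
    uplusTwist a d hr hs hr' hs' hpar (uplusWord a d r s w) =
      (r⁻¹ * r') ^ twistExp a d w • uplusWord a d r' s' w := by
  have h := prod_twistedMulLeft_uplusWord a d r' s' (mul_ne_zero (inv_ne_zero hr) hr') w []
  simp only [twistExp, zpow_zero, one_smul, List.append_nil] at h
  rw [uplusTwist, LinearMap.comp_apply, AlgHom.toLinearMap_apply, uplusLift_uplusWord, ← h]
  rfl

theorem uplusTwist_comp_uplusTwist {r s r' s' : K} (hr : r ≠ 0) (hs : s ≠ 0) (hr' : r' ≠ 0)
    (hs' : s' ≠ 0) (hpar : r * s⁻¹ = r' * s'⁻¹) :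
    uplusTwist a d hr' hs' hr hs hpar.symm ∘ₗ uplusTwist a d hr hs hr' hs' hpar =
      LinearMap.id := by
  refine LinearMap.ext_on_range (span_range_uplusWord a d r s) fun w => ?_
  rw [LinearMap.comp_apply, uplusTwist_uplusWord, map_smul, uplusTwist_uplusWord, smul_smul,
    ← mul_zpow, show r⁻¹ * r' * (r'⁻¹ * r) = 1 by field_simp, one_zpow, one_smul,
    LinearMap.id_apply]

/-- The linear isomorphism `U⁺_{r,s} ≃ U⁺_{r',s'}` underlying the cocycle deformation. -/
def uplusTwistEquiv {r s r' s' : K} (hr : r ≠ 0) (hs : s ≠ 0) (hr' : r' ≠ 0)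
    (hs' : s' ≠ 0) (hpar : r * s⁻¹ = r' * s'⁻¹) : Uplus K a d r s ≃ₗ[K] Uplus K a d r' s' :=
  LinearEquiv.ofLinearMap (uplusTwist a d hr hs hr' hs' hpar)
    (uplusTwist a d hr' hs' hr hs hpar.symm)
    (uplusTwist_comp_uplusTwist a d hr' hs' hr hs hpar.symm)
    (uplusTwist_comp_uplusTwist a d hr hs hr' hs' hpar)

theorem uplusTwistEquiv_uplusWord {r s r' s' : K} (hr : r ≠ 0) (hs : s ≠ 0) (hr' : r' ≠ 0)
    (hs' : s' ≠ 0) (hpar : r * s⁻¹ = r' * s'⁻¹) (w : List (Fin n)) :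
    uplusTwistEquiv a d hr hs hr' hs' hpar (uplusWord a d r s w) =
      (r⁻¹ * r') ^ twistExp a d w • uplusWord a d r' s' w :=
  uplusTwist_uplusWord a d hr hs hr' hs' hpar w

theorem uplusTwistEquiv_mul {r s r' s' : K} (hr : r ≠ 0) (hs : s ≠ 0) (hr' : r' ≠ 0)
    (hs' : s' ≠ 0) (hpar : r * s⁻¹ = r' * s'⁻¹) {μ ν : Fin n → ℕ} {x y : Uplus K a d r s}
    (hx : x ∈ UplusDeg K a d r s μ) (hy : y ∈ UplusDeg K a d r s ν) :
    uplusTwistEquiv a d hr hs hr' hs' hpar (x * y) =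
      ((r⁻¹ * r') ^ euler a d (fun i => (μ i : ℤ)) (fun i => (ν i : ℤ))) •
        (uplusTwistEquiv a d hr hs hr' hs' hpar x *
          uplusTwistEquiv a d hr hs hr' hs' hpar y) := by
  have ht : r⁻¹ * r' ≠ 0 := mul_ne_zero (inv_ne_zero hr) hr'
  induction hx, hy using Submodule.span_induction₂ with
  | mem_mem x y hx hy =>
    obtain ⟨u, hu, rfl⟩ := hx
    obtain ⟨w, hw, rfl⟩ := hy
    simp only [← hu, ← hw]
    change uplusTwistEquiv a d hr hs hr' hs' hpar (uplusWord a d r s u * uplusWord a d r s w) =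
      (r⁻¹ * r') ^ euler a d (wordWeight u) (wordWeight w) •
        (uplusTwistEquiv a d hr hs hr' hs' hpar (uplusWord a d r s u) *
          uplusTwistEquiv a d hr hs hr' hs' hpar (uplusWord a d r s w))
    rw [← uplusWord_append, uplusTwistEquiv_uplusWord, uplusTwistEquiv_uplusWord,
      uplusTwistEquiv_uplusWord, smul_mul_smul_comm, smul_smul, ← uplusWord_append,
      twistExp_append, zpow_add₀ ht, zpow_add₀ ht, mul_comm]
  | zero_left => simp
  | zero_right => simp
  | add_left x y z _ _ _ hxz hyz => simp only [add_mul, map_add, smul_add, hxz, hyz]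
  | add_right x y z _ _ _ hxy hxz => simp only [mul_add, map_add, smul_add, hxy, hxz]
  | smul_left c x y _ _ h => rw [smul_mul_assoc, map_smul, h, map_smul, smul_mul_assoc, smul_comm]
  | smul_right c x y _ _ h => rw [mul_smul_comm, map_smul, h, map_smul, mul_smul_comm, smul_comm]

theorem map_uplusTwistEquiv_uplusDeg_le {r s r' s' : K} (hr : r ≠ 0) (hs : s ≠ 0) (hr' : r' ≠ 0)
    (hs' : s' ≠ 0) (hpar : r * s⁻¹ = r' * s'⁻¹) (μ : Fin n → ℕ) :
    (UplusDeg K a d r s μ).map (uplusTwistEquiv a d hr hs hr' hs' hpar).toLinearMap ≤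
      UplusDeg K a d r' s' μ := by
  rw [UplusDeg, Submodule.map_span_le]
  rintro _ ⟨w, hw, rfl⟩
  rw [LinearEquiv.coe_coe]
  change uplusTwistEquiv a d hr hs hr' hs' hpar (uplusWord a d r s w) ∈ _
  rw [uplusTwistEquiv_uplusWord]
  exact Submodule.smul_mem _ _ (Submodule.subset_span ⟨w, hw, rfl⟩)

theorem map_uplusTwistEquiv_uplusDeg {r s r' s' : K} (hr : r ≠ 0) (hs : s ≠ 0) (hr' : r' ≠ 0)
    (hs' : s' ≠ 0) (hpar : r * s⁻¹ = r' * s'⁻¹) (μ : Fin n → ℕ) :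
    (UplusDeg K a d r s μ).map (uplusTwistEquiv a d hr hs hr' hs' hpar).toLinearMap =
      UplusDeg K a d r' s' μ := by
  refine (map_uplusTwistEquiv_uplusDeg_le a d hr hs hr' hs' hpar μ).antisymm fun x hx => ?_
  exact ⟨(uplusTwistEquiv a d hr hs hr' hs' hpar).symm x,
    map_uplusTwistEquiv_uplusDeg_le a d hr' hs' hr hs hpar.symm μ ⟨x, hx, rfl⟩,
    LinearEquiv.apply_symm_apply _ x⟩

end Uplus

/-- **Theorem 3.2(I).** If `r s⁻¹ = r' s'⁻¹` (all parameters nonzero complex numbers), then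
`ψ(μ,ν) = (r⁻¹ r')^{⟨μ,ν⟩}` is a 2-cocycle (indeed a bicharacter) of the root lattice `Q`,
and `e_i ↦ e_i` gives an isomorphism of `Q⁺`-graded `ℂ`-algebras from `U⁺_{r,s}` onto the
cocycle deformation `(U⁺_{r',s'})^ψ`; in particular `U⁺_{r,s}` and `U⁺_{r',s'}` are
2-cocycle deformations of each other. -/
theorem Uplus_cocycle_deformation_of_ratio_eq
    (n : ℕ) (a : Fin n → Fin n → ℤ) (d : Fin n → ℤ)
    (hdiag : ∀ i, a i i = 2) (hoff : ∀ i j, i ≠ j → a i j ≤ 0)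
    (hsym : ∀ i j, d i * a i j = d j * a j i) (hdpos : ∀ i, 0 < d i)
    (hfin : Matrix.PosDef (Matrix.of fun i j : Fin n => ((d i * a i j : ℤ) : ℝ)))
    (r s r' s' : ℂ) (hr : r ≠ 0) (hs : s ≠ 0) (hr' : r' ≠ 0) (hs' : s' ≠ 0)
    (hpar : r * s⁻¹ = r' * s'⁻¹) :
    (∀ μ ν lam : Fin n → ℤ,
        (r⁻¹ * r') ^ euler a d μ ν * (r⁻¹ * r') ^ euler a d (μ + ν) lam =
          (r⁻¹ * r') ^ euler a d ν lam * (r⁻¹ * r') ^ euler a d μ (ν + lam)) ∧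
    (∀ μ μ' ν : Fin n → ℤ,
        (r⁻¹ * r') ^ euler a d (μ + μ') ν =
          (r⁻¹ * r') ^ euler a d μ ν * (r⁻¹ * r') ^ euler a d μ' ν) ∧
    (∀ μ ν ν' : Fin n → ℤ,
        (r⁻¹ * r') ^ euler a d μ (ν + ν') =
          (r⁻¹ * r') ^ euler a d μ ν * (r⁻¹ * r') ^ euler a d μ ν') ∧
    ∃ Φ : Uplus ℂ a d r s ≃ₗ[ℂ] Uplus ℂ a d r' s',
      (∀ i, Φ (eP ℂ a d r s i) = eP ℂ a d r' s' i) ∧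
      Φ 1 = 1 ∧
      (∀ (μ ν : Fin n → ℕ) (x y : Uplus ℂ a d r s),
          x ∈ UplusDeg ℂ a d r s μ → y ∈ UplusDeg ℂ a d r s ν →
          Φ (x * y) =
            ((r⁻¹ * r') ^ euler a d (fun i => (μ i : ℤ)) (fun i => (ν i : ℤ))) •
              (Φ x * Φ y)) ∧
      (∀ μ : Fin n → ℕ,
          Submodule.map Φ.toLinearMap (UplusDeg ℂ a d r s μ) = UplusDeg ℂ a d r' s' μ) := by
  have ht : r⁻¹ * r' ≠ 0 := mul_ne_zero (inv_ne_zero hr) hr'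
  refine ⟨fun μ ν lam => ?_, fun μ μ' ν => ?_, fun μ ν ν' => ?_,
    uplusTwistEquiv a d hr hs hr' hs' hpar, fun i => ?_, ?_,
    fun _ _ _ _ => uplusTwistEquiv_mul a d hr hs hr' hs' hpar,
    map_uplusTwistEquiv_uplusDeg a d hr hs hr' hs' hpar⟩
  · rw [← zpow_add₀ ht, ← zpow_add₀ ht, euler_add_left, euler_add_right]
    congr 1
    ring
  · rw [euler_add_left, zpow_add₀ ht]
  · rw [euler_add_right, zpow_add₀ ht]
  · simpa [uplusWord, twistExp] using uplusTwistEquiv_uplusWord a d hr hs hr' hs' hpar [i]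
  · simpa [uplusWord, twistExp] using uplusTwistEquiv_uplusWord a d hr hs hr' hs' hpar []

end
end

section
/- There exists a ring automorphism Φ of U_{r,s}(𝔤) which is ℚ-linear and semilinear over the field automorphism of ℚ(r,s) determined by r ↦ s^{−1}, s ↦ r^{−1}, such that Φ(e_i) = f_i, Φ(f_i) = r_i s_i e_i, Φ(ω_i) = ω_i', and Φ(ω_i') = ω_i for every i ∈ I. -/
noncomputable section

/-- The `(r,s)`-Serre element for the negative generators:
`∑_{k=0}^{1-a_{ij}} (-1)^k binom(1-a_{ij},k)_{r_i s_i⁻¹} c^{(k)}_{ij} F_i^k F_j F_i^{1-a_{ij}-k}`. -/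
def serreEltF {K : Type} [Field K] {n : ℕ} (a : Fin n → Fin n → ℤ) (d : Fin n → ℤ)
    (r s : K) {A : Type} [Ring A] [Algebra K A] (F : Fin n → A) (i j : Fin n) : A :=
  ∑ k ∈ Finset.range ((1 - a i j).toNat + 1),
    ((-1 : K) ^ k * qbinom (r ^ d i * (s ^ d i)⁻¹) ((1 - a i j).toNat) k *
        ccoef a d r s i j k) •
      (F i ^ k * F j * F i ^ ((1 - a i j).toNat - k))

/-- The field `ℚ(r,s)` of rational functions in two variables over `ℚ`. -/
abbrev K2 : Type := FractionRing (MvPolynomial (Fin 2) ℚ)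

/-- The parameter `r ∈ ℚ(r,s)`. -/
def rr : K2 := algebraMap (MvPolynomial (Fin 2) ℚ) K2 (MvPolynomial.X 0)

/-- The parameter `s ∈ ℚ(r,s)`. -/
def ss : K2 := algebraMap (MvPolynomial (Fin 2) ℚ) K2 (MvPolynomial.X 1)

/-- Generators of the two-parameter quantum group `U_{r,s}(𝔤)`:
`e_i, f_i, ω_i^{±1}, ω_i'^{±1}`. -/
inductive Gen (n : ℕ) : Type
  | e (i : Fin n) : Gen n
  | f (i : Fin n) : Gen n
  | w (i : Fin n) : Gen n
  | winv (i : Fin n) : Gen n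
  | w' (i : Fin n) : Gen n
  | w'inv (i : Fin n) : Gen n

/-- The four toral generators `ω_i, ω_i^{-1}, ω_i', ω_i'^{-1}` attached to `i`. -/
def tor {n : ℕ} (i : Fin n) : Bool → Bool → Gen n
  | false, false => Gen.w i
  | false, true => Gen.winv i
  | true, false => Gen.w' i
  | true, true => Gen.w'inv i

/-- The defining relations (R1)–(R6) of the two-parameter quantum group `U_{r,s}(𝔤)`. -/
inductive URel {n : ℕ} (a : Fin n → Fin n → ℤ) (d : Fin n → ℤ) :
    FreeAlgebra K2 (Gen n) → FreeAlgebra K2 (Gen n) → Prop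
  | torComm (i j : Fin n) (p q p' q' : Bool) :
      URel a d (FreeAlgebra.ι K2 (tor i p q) * FreeAlgebra.ι K2 (tor j p' q'))
        (FreeAlgebra.ι K2 (tor j p' q') * FreeAlgebra.ι K2 (tor i p q))
  | wInvR (i : Fin n) :
      URel a d (FreeAlgebra.ι K2 (Gen.w i) * FreeAlgebra.ι K2 (Gen.winv i)) 1
  | wInvL (i : Fin n) :
      URel a d (FreeAlgebra.ι K2 (Gen.winv i) * FreeAlgebra.ι K2 (Gen.w i)) 1
  | w'InvR (i : Fin n) :
      URel a d (FreeAlgebra.ι K2 (Gen.w' i) * FreeAlgebra.ι K2 (Gen.w'inv i)) 1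
  | w'InvL (i : Fin n) :
      URel a d (FreeAlgebra.ι K2 (Gen.w'inv i) * FreeAlgebra.ι K2 (Gen.w' i)) 1
  | we (i j : Fin n) :
      URel a d (FreeAlgebra.ι K2 (Gen.w i) * FreeAlgebra.ι K2 (Gen.e j))
        ((rr ^ eulB a d j i * (ss ^ eulB a d i j)⁻¹) •
          (FreeAlgebra.ι K2 (Gen.e j) * FreeAlgebra.ι K2 (Gen.w i)))
  | w'e (i j : Fin n) :
      URel a d (FreeAlgebra.ι K2 (Gen.w' i) * FreeAlgebra.ι K2 (Gen.e j))
        (((rr ^ eulB a d i j)⁻¹ * ss ^ eulB a d j i) •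
          (FreeAlgebra.ι K2 (Gen.e j) * FreeAlgebra.ι K2 (Gen.w' i)))
  | wf (i j : Fin n) :
      URel a d (FreeAlgebra.ι K2 (Gen.w i) * FreeAlgebra.ι K2 (Gen.f j))
        (((rr ^ eulB a d j i)⁻¹ * ss ^ eulB a d i j) •
          (FreeAlgebra.ι K2 (Gen.f j) * FreeAlgebra.ι K2 (Gen.w i)))
  | w'f (i j : Fin n) :
      URel a d (FreeAlgebra.ι K2 (Gen.w' i) * FreeAlgebra.ι K2 (Gen.f j))
        ((rr ^ eulB a d i j * (ss ^ eulB a d j i)⁻¹) •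
          (FreeAlgebra.ι K2 (Gen.f j) * FreeAlgebra.ι K2 (Gen.w' i)))
  | ef (i j : Fin n) :
      URel a d
        (FreeAlgebra.ι K2 (Gen.e i) * FreeAlgebra.ι K2 (Gen.f j) -
          FreeAlgebra.ι K2 (Gen.f j) * FreeAlgebra.ι K2 (Gen.e i))
        (if i = j then
          ((rr ^ d i - ss ^ d i)⁻¹) •
            (FreeAlgebra.ι K2 (Gen.w i) - FreeAlgebra.ι K2 (Gen.w' i))
         else 0)
  | serreE (i j : Fin n) (h : i ≠ j) :
      URel a d (serreElt a d rr ss (fun k => FreeAlgebra.ι K2 (Gen.e k)) i j) 0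
  | serreF (i j : Fin n) (h : i ≠ j) :
      URel a d (serreEltF a d rr ss (fun k => FreeAlgebra.ι K2 (Gen.f k)) i j) 0

/-- The two-parameter quantum group `U_{r,s}(𝔤)` over `ℚ(r,s)`. -/
abbrev Uq {n : ℕ} (a : Fin n → Fin n → ℤ) (d : Fin n → ℤ) : Type :=
  RingQuot (URel a d)

/-- The image of a generator in `U_{r,s}(𝔤)`. -/
def gU {n : ℕ} (a : Fin n → Fin n → ℤ) (d : Fin n → ℤ) (x : Gen n) : Uq a d :=
  RingQuot.mkAlgHom K2 (URel a d) (FreeAlgebra.ι K2 x)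

/-- The subalgebra `U⁺` of `U_{r,s}(𝔤)` generated by the `e_i`. -/
def Upos {n : ℕ} (a : Fin n → Fin n → ℤ) (d : Fin n → ℤ) : Subalgebra K2 (Uq a d) :=
  Algebra.adjoin K2 (Set.range fun i => gU a d (Gen.e i))

/-- The subalgebra `U⁻` of `U_{r,s}(𝔤)` generated by the `f_i`. -/
def Uneg {n : ℕ} (a : Fin n → Fin n → ℤ) (d : Fin n → ℤ) : Subalgebra K2 (Uq a d) :=
  Algebra.adjoin K2 (Set.range fun i => gU a d (Gen.f i))

/-- The subalgebra `U⁰` of `U_{r,s}(𝔤)` generated by the `ω_i^{±1}, ω_i'^{±1}`. -/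
def Uzero {n : ℕ} (a : Fin n → Fin n → ℤ) (d : Fin n → ℤ) : Subalgebra K2 (Uq a d) :=
  Algebra.adjoin K2 (Set.range fun p : Fin n × Bool × Bool => gU a d (tor p.1 p.2.1 p.2.2))

/-- The generator `e_i` of `U⁺ ⊆ U_{r,s}(𝔤)`, as an element of the subalgebra `U⁺`. -/
def eUp {n : ℕ} (a : Fin n → Fin n → ℤ) (d : Fin n → ℤ) (i : Fin n) : ↥(Upos a d) :=
  ⟨gU a d (Gen.e i), Algebra.subset_adjoin (Set.mem_range_self i)⟩

section QBinomial

variable {K : Type} [CommRing K] (v : K)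

@[simp] lemma qbinom_zero_right (m : ℕ) : qbinom v m 0 = 1 := by
  cases m <;> simp [qbinom]

lemma qbinom_succ_succ (m k : ℕ) :
    qbinom v (m + 1) (k + 1) = qbinom v m k + v ^ (k + 1) * qbinom v m (k + 1) := by
  simp [qbinom]

lemma qbinom_eq_zero_of_lt {m k : ℕ} (h : m < k) : qbinom v m k = 0 := by
  induction m generalizing k with
  | zero => obtain _ | k := k <;> simp_all [qbinom]
  | succ m ih =>
    obtain _ | k := k
    · omega
    · rw [qbinom_succ_succ, ih (by omega), ih (by omega)]; simp

@[simp] lemma qbinom_self (m : ℕ) : qbinom v m m = 1 := by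
  induction m with
  | zero => simp
  | succ m ih => rw [qbinom_succ_succ, ih, qbinom_eq_zero_of_lt v (Nat.lt_succ_self m)]; simp

/-- The second Pascal rule for Gaussian binomial coefficients. -/
lemma qbinom_add_succ (k l : ℕ) :
    qbinom v (k + l + 1) (k + 1) = v ^ l * qbinom v (k + l) k + qbinom v (k + l) (k + 1) := by
  induction h : k + l generalizing k l with
  | zero =>
    obtain ⟨rfl, rfl⟩ : k = 0 ∧ l = 0 := by omega
    simp [qbinom]
  | succ m ih =>
    rw [qbinom_succ_succ v (m + 1) k]
    obtain _ | k := k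
    · obtain rfl : l = m + 1 := by omega
      have h₁ := ih 0 m (by omega)
      have h₂ := qbinom_succ_succ v m 0
      simp only [qbinom_zero_right, zero_add, pow_one] at h₁ h₂ ⊢
      linear_combination v * h₁ - h₂
    · obtain _ | l := l
      · obtain rfl : m = k := by omega
        simp [qbinom_eq_zero_of_lt]
      · have h₁ := ih k (l + 1) (by omega)
        have h₂ := ih (k + 1) l (by omega)
        have h₃ := qbinom_succ_succ v m k
        have h₄ := qbinom_succ_succ v m (k + 1)
        linear_combination h₁ + v ^ (k + 2) * h₂ - v ^ (l + 1) * h₃ - h₄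

/-- Symmetry of Gaussian binomial coefficients. -/
lemma qbinom_symm_add (k l : ℕ) : qbinom v (k + l) k = qbinom v (k + l) l := by
  induction h : k + l generalizing k l with
  | zero =>
    obtain ⟨rfl, rfl⟩ : k = 0 ∧ l = 0 := by omega
    rfl
  | succ m ih =>
    obtain _ | k := k
    · obtain rfl : l = m + 1 := by omega
      simp
    · obtain _ | l := l
      · obtain rfl : m = k := by omega
        simp
      · rw [qbinom_succ_succ]
        obtain rfl : m = l + (k + 1) := by omega
        rw [qbinom_add_succ v l (k + 1), ih k (l + 1) (by omega), ih (k + 1) l (by omega)]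
        ring

end QBinomial

section SerreCoefficients

variable {K : Type} [Field K] {n : ℕ} (a : Fin n → Fin n → ℤ) (d : Fin n → ℤ)

lemma map_qbinom {K L : Type} [CommRing K] [CommRing L] (φ : K →+* L) (v : K) (m k : ℕ) :
    φ (qbinom v m k) = qbinom (φ v) m k := by
  induction m generalizing k with
  | zero => cases k <;> simp [qbinom]
  | succ m ih => cases k <;> simp [qbinom, ih]

lemma map_serreCoef {L : Type} [Field L] (φ : K →+* L) (r s : K) (i j : Fin n) (k : ℕ) :
    φ (serreCoef a d r s i j k) = serreCoef a d (φ r) (φ s) i j k := by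
  simp [serreCoef, ccoef, map_qbinom, map_zpow₀]

lemma ccoef_eq_zpow {r s : K} (hr : r ≠ 0) (hs : s ≠ 0) (i j : Fin n) (k : ℕ) :
    ccoef a d r s i j k =
      r ^ (d i * (k * (k - 1) / 2 : ℕ) + k * eulB a d j i) *
        s ^ (-(d i * (k * (k - 1) / 2 : ℕ) + k * eulB a d i j)) := by
  rw [ccoef, zpow_neg, zpow_add₀ hr, zpow_add₀ hs, zpow_mul r (d i), zpow_mul s (d i),
    zpow_natCast, zpow_natCast, mul_pow, inv_pow, mul_inv]
  ring

lemma two_mul_triangle (k : ℕ) : 2 * ((k * (k - 1) / 2 : ℕ) : ℤ) = k * (k - 1) := by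
  have h := Nat.mul_div_cancel' (Nat.even_mul_pred_self k).two_dvd
  obtain _ | k := k
  · simp
  · zify at h
    simpa using h

variable {a d}

lemma eulB_add_eulB (hsym : ∀ i j, d i * a i j = d j * a j i) {i j : Fin n} (h : i ≠ j) :
    eulB a d i j + eulB a d j i = d i * a i j := by
  rcases lt_or_gt_of_ne h with h' | h'
  · simp [eulB, h', h'.not_gt, h.symm]
  · simp [eulB, h', h'.not_gt, h, hsym i j]

lemma serreCoef_inv_swap (hoff : ∀ i j, i ≠ j → a i j ≤ 0)
    (hsym : ∀ i j, d i * a i j = d j * a j i) {r s : K} (hr : r ≠ 0) (hs : s ≠ 0)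
    {i j : Fin n} (h : i ≠ j) {k l : ℕ} (hkl : k + l = (1 - a i j).toNat) :
    serreCoef a d s⁻¹ r⁻¹ i j k =
      serreCoef a d s⁻¹ r⁻¹ i j (k + l) * serreCoef a d r s i j l := by
  have hq : s⁻¹ ^ d i * (r⁻¹ ^ d i)⁻¹ = r ^ d i * (s ^ d i)⁻¹ := by
    simp [mul_comm]
  have hc : ccoef a d s⁻¹ r⁻¹ i j k =
      ccoef a d s⁻¹ r⁻¹ i j (k + l) * ccoef a d r s i j l := by
    have hm : ((k + l : ℕ) : ℤ) = 1 - a i j := by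
      rw [hkl, Int.toNat_of_nonneg (by linarith [hoff i j h])]
    rw [ccoef_eq_zpow a d (inv_ne_zero hs) (inv_ne_zero hr),
      ccoef_eq_zpow a d (inv_ne_zero hs) (inv_ne_zero hr), ccoef_eq_zpow a d hr hs]
    simp only [inv_zpow', neg_neg]
    have h₁ := two_mul_triangle k
    have h₂ := two_mul_triangle l
    have h₃ := two_mul_triangle (k + l)
    have h₄ := eulB_add_eulB hsym h
    set T₁ : ℤ := ((k * (k - 1) / 2 : ℕ) : ℤ)
    set T₂ : ℤ := ((l * (l - 1) / 2 : ℕ) : ℤ)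
    set T₃ : ℤ := (((k + l) * (k + l - 1) / 2 : ℕ) : ℤ)
    push_cast at hm h₃ ⊢
    have h₅ : T₃ + T₂ = T₁ - l * a i j := by
      have : 2 * (T₃ + T₂) = 2 * (T₁ - l * a i j) := by
        linear_combination h₃ + h₂ - h₁ + 2 * (l : ℤ) * hm
      linarith
    have h₆ (x y z w : ℤ) : s ^ x * r ^ y * (r ^ z * s ^ w) = s ^ (x + w) * r ^ (y + z) := by
      rw [zpow_add₀ hr, zpow_add₀ hs]; ring
    rw [h₆]
    congr 2
    · linear_combination d i * h₅ + l * h₄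
    · linear_combination -(d i * h₅) - l * h₄
  simp only [serreCoef, hq, hc, ← hkl, qbinom_self, qbinom_symm_add _ k l, pow_add]
  have : ((-1 : K) ^ l) * (-1) ^ l = 1 := by rw [← mul_pow]; simp
  linear_combination (-(-1) ^ k * qbinom (r ^ d i * (s ^ d i)⁻¹) (k + l) l *
    ccoef a d s⁻¹ r⁻¹ i j (k + l) * ccoef a d r s i j l) * this

end SerreCoefficients

section Semilinear

variable {K A B X : Type} [Field K] [Ring A] [Algebra K A] [Ring B] [Algebra K B]

/-- A ring homomorphism of `K`-algebras that restricts to `φ` on scalars is `φ`-semilinear. -/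
lemma map_smul_of_map_algebraMap {φ : K →+* K} {F : A →+* B}
    (hF : ∀ c, F (algebraMap K A c) = algebraMap K B (φ c)) (c : K) (x : A) :
    F (c • x) = φ c • F x := by
  rw [Algebra.smul_def, map_mul, hF, Algebra.smul_def]

/-- The `φ`-semilinear ring homomorphism out of a free algebra with given values on the
generators. -/
def freeSemilift (φ : K →+* K) (g : X → A) : FreeAlgebra K X →+* A :=
  letI : Algebra K A := Algebra.compHom A φ
  (FreeAlgebra.lift K g).toRingHom

@[simp] lemma freeSemilift_ι (φ : K →+* K) (g : X → A) (x : X) :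
    freeSemilift φ g (FreeAlgebra.ι K x) = g x :=
  letI : Algebra K A := Algebra.compHom A φ
  FreeAlgebra.lift_ι_apply g x

lemma freeSemilift_algebraMap (φ : K →+* K) (g : X → A) (c : K) :
    freeSemilift φ g (algebraMap K _ c) = algebraMap K A (φ c) :=
  letI : Algebra K A := Algebra.compHom A φ
  (FreeAlgebra.lift K g).commutes c

@[simp] lemma freeSemilift_smul (φ : K →+* K) (g : X → A) (c : K) (x : FreeAlgebra K X) :
    freeSemilift φ g (c • x) = φ c • freeSemilift φ g x :=
  map_smul_of_map_algebraMap (freeSemilift_algebraMap φ g) c x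

end Semilinear

section SerreElements

variable {K : Type} [Field K] {n : ℕ} {a : Fin n → Fin n → ℤ} {d : Fin n → ℤ}
  {A B : Type} [Ring A] [Algebra K A] [Ring B] [Algebra K B]

lemma serreElt_eq_sum (r s : K) (E : Fin n → A) (i j : Fin n) :
    serreElt a d r s E i j = ∑ p ∈ Finset.HasAntidiagonal.antidiagonal (1 - a i j).toNat,
      serreCoef a d r s i j p.1 • (E i ^ p.2 * E j * E i ^ p.1) := by
  rw [Finset.Nat.sum_antidiagonal_eq_sum_range_succ_mk]
  rfl

lemma serreEltF_eq_sum (r s : K) (F : Fin n → A) (i j : Fin n) :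
    serreEltF a d r s F i j = ∑ p ∈ Finset.HasAntidiagonal.antidiagonal (1 - a i j).toNat,
      serreCoef a d r s i j p.1 • (F i ^ p.1 * F j * F i ^ p.2) := by
  rw [Finset.Nat.sum_antidiagonal_eq_sum_range_succ_mk]
  rfl

/-- A semilinear map over `r ↦ s⁻¹`, `s ↦ r⁻¹` exchanges the two kinds of Serre elements. -/
lemma map_serreElt_s5 (hoff : ∀ i j, i ≠ j → a i j ≤ 0) (hsym : ∀ i j, d i * a i j = d j * a j i)
    {r s : K} (hr : r ≠ 0) (hs : s ≠ 0) {φ : K →+* K} (hφr : φ r = s⁻¹) (hφs : φ s = r⁻¹)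
    {Ψ : A →+* B} (hΨ : ∀ (c : K) (x : A), Ψ (c • x) = φ c • Ψ x)
    {E : Fin n → A} {F : Fin n → B} {x : Fin n → K} (hE : ∀ i, Ψ (E i) = x i • F i)
    {i j : Fin n} (h : i ≠ j) :
    Ψ (serreElt a d r s E i j) =
      (serreCoef a d s⁻¹ r⁻¹ i j (1 - a i j).toNat * x i ^ (1 - a i j).toNat * x j) •
        serreEltF a d r s F i j := by
  rw [serreElt_eq_sum, serreEltF_eq_sum, ← Finset.Nat.sum_antidiagonal_swap, map_sum, Finset.smul_sum]
  refine Finset.sum_congr rfl fun p hp => ?_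
  have hp' : p.2 + p.1 = (1 - a i j).toNat := by
    rw [add_comm]; exact Finset.HasAntidiagonal.mem_antidiagonal.mp hp
  simp only [hΨ, map_mul, map_pow, hE, smul_pow, smul_mul_assoc, mul_smul_comm, smul_smul,
    map_serreCoef, hφr, hφs, Prod.fst_swap, Prod.snd_swap]
  rw [serreCoef_inv_swap hoff hsym hr hs h hp', ← hp', pow_add]
  congr 1
  ring

lemma map_serreEltF (hoff : ∀ i j, i ≠ j → a i j ≤ 0) (hsym : ∀ i j, d i * a i j = d j * a j i)
    {r s : K} (hr : r ≠ 0) (hs : s ≠ 0) {φ : K →+* K} (hφr : φ r = s⁻¹) (hφs : φ s = r⁻¹)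
    {Ψ : A →+* B} (hΨ : ∀ (c : K) (x : A), Ψ (c • x) = φ c • Ψ x)
    {E : Fin n → A} {F : Fin n → B} {x : Fin n → K} (hE : ∀ i, Ψ (E i) = x i • F i)
    {i j : Fin n} (h : i ≠ j) :
    Ψ (serreEltF a d r s E i j) =
      (serreCoef a d s⁻¹ r⁻¹ i j (1 - a i j).toNat * x i ^ (1 - a i j).toNat * x j) •
        serreElt a d r s F i j := by
  rw [serreElt_eq_sum, serreEltF_eq_sum, ← Finset.Nat.sum_antidiagonal_swap, map_sum, Finset.smul_sum]
  refine Finset.sum_congr rfl fun p hp => ?_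
  have hp' : p.2 + p.1 = (1 - a i j).toNat := by
    rw [add_comm]; exact Finset.HasAntidiagonal.mem_antidiagonal.mp hp
  simp only [hΨ, map_mul, map_pow, hE, smul_pow, smul_mul_assoc, mul_smul_comm, smul_smul,
    map_serreCoef, hφr, hφs, Prod.fst_swap, Prod.snd_swap]
  rw [serreCoef_inv_swap hoff hsym hr hs h hp', ← hp', pow_add]
  congr 1
  ring

end SerreElements

section Parameters

lemma rr_ne_zero : rr ≠ 0 := by
  simp [rr]

lemma ss_ne_zero : ss ≠ 0 := by
  simp [ss]

lemma K2_ringHom_ext {L : Type} [Field L] {f g : K2 →+* L} (hr : f rr = g rr) (hs : f ss = g ss) :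
    f = g := by
  refine IsLocalization.ringHom_ext (nonZeroDivisors (MvPolynomial (Fin 2) ℚ)) ?_
  refine MvPolynomial.ringHom_ext (fun q => ?_) (fun i => ?_)
  · exact DFunLike.congr_fun (Subsingleton.elim
      ((f.comp (algebraMap _ K2)).comp MvPolynomial.C) ((g.comp (algebraMap _ K2)).comp MvPolynomial.C)) q
  · fin_cases i
    · exact hr
    · exact hs

end Parameters

section FieldAutomorphism

/-- The ring `ℚ[r, s]` localized at `rs`, that is, `ℚ[r^{±1}, s^{±1}]`. -/
abbrev Laurent2 : Type :=
  Localization.Away (MvPolynomial.X 0 * MvPolynomial.X 1 : MvPolynomial (Fin 2) ℚ)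

lemma powers_le_nonZeroDivisors : Submonoid.powers
    (MvPolynomial.X 0 * MvPolynomial.X 1 : MvPolynomial (Fin 2) ℚ) ≤ nonZeroDivisors _ :=
  powers_le_nonZeroDivisors_of_noZeroDivisors
    (mul_ne_zero (MvPolynomial.X_ne_zero _) (MvPolynomial.X_ne_zero _))

/-- Evaluation of a polynomial at `(s⁻¹, r⁻¹)`. -/
def evalInvSwap : MvPolynomial (Fin 2) ℚ →ₐ[ℚ] K2 := MvPolynomial.aeval ![ss⁻¹, rr⁻¹]

lemma isUnit_algebraMap_X (i : Fin 2) :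
    IsUnit (algebraMap (MvPolynomial (Fin 2) ℚ) Laurent2 (MvPolynomial.X i)) := by
  have h := IsLocalization.Away.algebraMap_isUnit (S := Laurent2)
    (MvPolynomial.X 0 * MvPolynomial.X 1 : MvPolynomial (Fin 2) ℚ)
  rw [map_mul, IsUnit.mul_iff] at h
  fin_cases i
  exacts [h.1, h.2]

lemma evalInvSwap_injective : Function.Injective evalInvSwap := by
  let x (i : Fin 2) : Laurent2ˣ := (isUnit_algebraMap_X i).unit
  let h : MvPolynomial (Fin 2) ℚ →ₐ[ℚ] Laurent2 :=
    MvPolynomial.aeval fun i => ((x (Equiv.swap 0 1 i))⁻¹ : Laurent2ˣ)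
  have hX (i : Fin 2) : h (MvPolynomial.X i) = ((x (Equiv.swap 0 1 i))⁻¹ : Laurent2ˣ) := by
    simp [h]
  have hunit : IsUnit ((h : MvPolynomial (Fin 2) ℚ →+* Laurent2)
      (MvPolynomial.X 0 * MvPolynomial.X 1)) := by
    simp only [RingHom.coe_coe, map_mul, hX]
    exact (Units.isUnit _).mul (Units.isUnit _)
  let g : Laurent2 →+* Laurent2 := IsLocalization.Away.lift _ hunit
  have hg (p) : g (algebraMap _ _ p) = h p := IsLocalization.Away.lift_eq _ hunit p
  have hgx (i : Fin 2) : g (x i) = ((x (Equiv.swap 0 1 i))⁻¹ : Laurent2ˣ) := by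
    rw [← hX, ← hg]; rfl
  have hgg (p) : g (h p) = algebraMap _ _ p := by
    have : (g.comp (h : MvPolynomial (Fin 2) ℚ →+* Laurent2)) = algebraMap _ _ := by
      refine MvPolynomial.ringHom_ext (fun q => ?_) (fun i => ?_)
      · exact DFunLike.congr_fun (Subsingleton.elim
          ((g.comp (h : MvPolynomial (Fin 2) ℚ →+* Laurent2)).comp MvPolynomial.C)
          ((algebraMap _ Laurent2).comp MvPolynomial.C)) q
      · have hu : Units.map (g : Laurent2 →* Laurent2) (x (Equiv.swap 0 1 i)) = (x i)⁻¹ := by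
          ext; simpa using hgx (Equiv.swap 0 1 i)
        have := congrArg (fun u => ((u⁻¹ : Laurent2ˣ) : Laurent2)) hu
        simp only [← map_inv, inv_inv] at this
        simp only [RingHom.comp_apply, RingHom.coe_coe, hX]
        exact this
    exact DFunLike.congr_fun this p
  have hinj : Function.Injective h := fun p q hpq =>
    IsLocalization.injective Laurent2 powers_le_nonZeroDivisors (by rw [← hgg, hpq, hgg])
  have hK : ∀ y : Submonoid.powers (MvPolynomial.X 0 * MvPolynomial.X 1 : MvPolynomial (Fin 2) ℚ),
      IsUnit (algebraMap (MvPolynomial (Fin 2) ℚ) K2 y) := fun y =>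
    IsLocalization.map_units K2 (⟨y, powers_le_nonZeroDivisors y.2⟩ :
      nonZeroDivisors (MvPolynomial (Fin 2) ℚ))
  let k : Laurent2 →+* K2 := IsLocalization.lift hK
  have hk (p) : k (algebraMap _ _ p) = algebraMap _ K2 p := IsLocalization.lift_eq hK p
  have hkinj : Function.Injective k := by
    rw [IsLocalization.lift_injective_iff]
    intro p q
    rw [(IsLocalization.injective Laurent2 powers_le_nonZeroDivisors).eq_iff,
      (IsFractionRing.injective _ K2).eq_iff]
  have hkx (i : Fin 2) : k (((x i)⁻¹ : Laurent2ˣ) : Laurent2) =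
      (algebraMap (MvPolynomial (Fin 2) ℚ) K2 (MvPolynomial.X i))⁻¹ := by
    rw [← hk]
    refine eq_inv_of_mul_eq_one_left ?_
    rw [← map_mul]
    exact (congrArg k (x i).inv_mul).trans (map_one k)
  have hcomp : (evalInvSwap : MvPolynomial (Fin 2) ℚ →+* K2) =
      k.comp (h : MvPolynomial (Fin 2) ℚ →+* Laurent2) := by
    refine MvPolynomial.ringHom_ext (fun q => ?_) (fun i => ?_)
    · exact DFunLike.congr_fun (Subsingleton.elim
        ((evalInvSwap : MvPolynomial (Fin 2) ℚ →+* K2).comp MvPolynomial.C)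
        ((k.comp (h : MvPolynomial (Fin 2) ℚ →+* Laurent2)).comp MvPolynomial.C)) q
    · simp only [RingHom.coe_coe, RingHom.comp_apply, hX, hkx]
      fin_cases i <;> simp [evalInvSwap, rr, ss]
  have := hkinj.comp hinj
  intro p q hpq
  exact this ((DFunLike.congr_fun hcomp p).symm.trans (hpq.trans (DFunLike.congr_fun hcomp q)))

/-- The endomorphism `r ↦ s⁻¹`, `s ↦ r⁻¹` of `ℚ(r,s)`. -/
def invSwapHom : K2 →+* K2 :=
  IsFractionRing.lift (g := evalInvSwap.toRingHom) evalInvSwap_injective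

@[simp] lemma invSwapHom_rr : invSwapHom rr = ss⁻¹ := by
  rw [invSwapHom, rr, IsFractionRing.lift_algebraMap]
  simp [evalInvSwap]

@[simp] lemma invSwapHom_ss : invSwapHom ss = rr⁻¹ := by
  rw [invSwapHom, ss, IsFractionRing.lift_algebraMap]
  simp [evalInvSwap]

lemma invSwapHom_comp_self : invSwapHom.comp invSwapHom = RingHom.id K2 :=
  K2_ringHom_ext (by simp) (by simp)

/-- The automorphism `r ↦ s⁻¹`, `s ↦ r⁻¹` of `ℚ(r,s)`. -/
def invSwap : K2 ≃+* K2 :=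
  RingEquiv.ofRingHom invSwapHom invSwapHom invSwapHom_comp_self invSwapHom_comp_self

end FieldAutomorphism

section QuantumGroup

variable {n : ℕ} {a : Fin n → Fin n → ℤ} {d : Fin n → ℤ}

/-- The images of the generators under the map `e_i ↦ x_i f_i`, `f_i ↦ y_i e_i`,
`ω_i ↔ ω_i'`. -/
def swapGen (a : Fin n → Fin n → ℤ) (d : Fin n → ℤ) (x y : Fin n → K2) : Gen n → Uq a d
  | Gen.e i => x i • gU a d (Gen.f i)
  | Gen.f i => y i • gU a d (Gen.e i)
  | Gen.w i => gU a d (Gen.w' i)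
  | Gen.winv i => gU a d (Gen.w'inv i)
  | Gen.w' i => gU a d (Gen.w i)
  | Gen.w'inv i => gU a d (Gen.winv i)

lemma swapGen_tor (x y : Fin n → K2) (i : Fin n) (p q : Bool) :
    swapGen a d x y (tor i p q) = gU a d (tor i (!p) q) := by
  cases p <;> cases q <;> rfl

lemma map_serreElt_algHom {A B : Type} [Ring A] [Algebra K2 A] [Ring B] [Algebra K2 B]
    (F : A →ₐ[K2] B) (E : Fin n → A) (i j : Fin n) :
    F (serreElt a d rr ss E i j) = serreElt a d rr ss (fun k => F (E k)) i j := by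
  simp [serreElt]

lemma map_serreEltF_algHom {A B : Type} [Ring A] [Algebra K2 A] [Ring B] [Algebra K2 B]
    (F : A →ₐ[K2] B) (E : Fin n → A) (i j : Fin n) :
    F (serreEltF a d rr ss E i j) = serreEltF a d rr ss (fun k => F (E k)) i j := by
  simp [serreEltF]

lemma smul_sub_smul_eq_neg_smul_sub {K A : Type} [CommRing K] [Ring A] [Algebra K A]
    (c : K) (u v : A) : c • u - c • v = -c • (v - u) := by
  module

lemma freeSemilift_swapGen_rel (hoff : ∀ i j, i ≠ j → a i j ≤ 0)
    (hsym : ∀ i j, d i * a i j = d j * a j i) {x y : Fin n → K2}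
    (hxy : ∀ i, x i * y i = rr ^ d i * ss ^ d i) {u v : FreeAlgebra K2 (Gen n)}
    (h : URel a d u v) :
    freeSemilift invSwapHom (swapGen a d x y) u = freeSemilift invSwapHom (swapGen a d x y) v := by
  have rel {u v} (h : URel a d u v) := RingQuot.mkAlgHom_rel K2 h
  cases h with
  | torComm i j p q p' q' =>
    simpa [swapGen_tor, gU] using rel (.torComm i j (!p) q (!p') q')
  | wInvR i => simpa [swapGen, gU] using rel (.w'InvR i)
  | wInvL i => simpa [swapGen, gU] using rel (.w'InvL i)
  | w'InvR i => simpa [swapGen, gU] using rel (.wInvR i)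
  | w'InvL i => simpa [swapGen, gU] using rel (.wInvL i)
  | we i j =>
    have := rel (.w'f i j)
    simp only [map_mul, map_smul] at this
    simp [swapGen, gU, this, smul_smul, map_zpow₀, mul_comm]
  | w'e i j =>
    have := rel (.wf i j)
    simp only [map_mul, map_smul] at this
    simp [swapGen, gU, this, smul_smul, map_zpow₀, mul_comm]
  | wf i j =>
    have := rel (.w'e i j)
    simp only [map_mul, map_smul] at this
    simp [swapGen, gU, this, smul_smul, map_zpow₀, mul_comm]
  | w'f i j =>
    have := rel (.we i j)
    simp only [map_mul, map_smul] at this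
    simp [swapGen, gU, this, smul_smul, map_zpow₀, mul_comm]
  | ef i j =>
    have := rel (.ef j i)
    simp only [map_sub, map_mul] at this
    have hl : freeSemilift invSwapHom (swapGen a d x y)
        (FreeAlgebra.ι K2 (Gen.e i) * FreeAlgebra.ι K2 (Gen.f j) -
          FreeAlgebra.ι K2 (Gen.f j) * FreeAlgebra.ι K2 (Gen.e i)) =
        -(x i * y j) • (gU a d (Gen.e j) * gU a d (Gen.f i) -
          gU a d (Gen.f i) * gU a d (Gen.e j)) := by
      simp only [map_sub, map_mul, freeSemilift_ι, swapGen, smul_mul_smul_comm]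
      rw [mul_comm (y j)]
      exact smul_sub_smul_eq_neg_smul_sub (A := Uq a d) _ _ _
    rw [hl, gU, gU, this]
    split_ifs with h₁ h₂ h₂
    · subst h₁
      simp only [map_smul, map_sub, freeSemilift_smul, freeSemilift_ι, swapGen, smul_smul, gU]
      rw [← neg_sub (RingQuot.mkAlgHom K2 (URel a d) (FreeAlgebra.ι K2 (Gen.w' j))), smul_neg,
        ← neg_smul]
      congr 1
      have hr := zpow_ne_zero (d j) rr_ne_zero
      have hs := zpow_ne_zero (d j) ss_ne_zero
      simp only [hxy, map_inv₀, map_sub, map_zpow₀, invSwapHom_rr, invSwapHom_ss, inv_zpow]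
      rw [inv_sub_inv hs hr, inv_div]
      ring
    · exact absurd h₁.symm h₂
    · exact absurd h₂.symm h₁
    · simp
  | serreE i j h =>
    rw [map_serreElt_s5 hoff hsym rr_ne_zero ss_ne_zero invSwapHom_rr invSwapHom_ss
      (freeSemilift_smul invSwapHom _) (F := fun i => gU a d (Gen.f i)) (x := x)
      (fun i => by simp [swapGen]) h, map_zero]
    have := rel (.serreF i j h)
    have := (map_serreEltF_algHom (A := FreeAlgebra K2 (Gen n)) (B := Uq a d)
      (RingQuot.mkAlgHom K2 (URel a d)) _ i j).symm.trans this
    rw [map_zero] at this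
    exact (congrArg _ this).trans (smul_zero _)
  | serreF i j h =>
    rw [map_serreEltF hoff hsym rr_ne_zero ss_ne_zero invSwapHom_rr invSwapHom_ss
      (freeSemilift_smul invSwapHom _) (F := fun i => gU a d (Gen.e i)) (x := y)
      (fun i => by simp [swapGen]) h, map_zero]
    have := rel (.serreE i j h)
    have := (map_serreElt_algHom (A := FreeAlgebra K2 (Gen n)) (B := Uq a d)
      (RingQuot.mkAlgHom K2 (URel a d)) _ i j).symm.trans this
    rw [map_zero] at this
    exact (congrArg _ this).trans (smul_zero _)

/-- The semilinear endomorphism `e_i ↦ x_i f_i`, `f_i ↦ y_i e_i`, `ω_i ↔ ω_i'` of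
`U_{r,s}(𝔤)`. -/
def swapHom (hoff : ∀ i j, i ≠ j → a i j ≤ 0)
    (hsym : ∀ i j, d i * a i j = d j * a j i) {x y : Fin n → K2}
    (hxy : ∀ i, x i * y i = rr ^ d i * ss ^ d i) : Uq a d →+* Uq a d :=
  RingQuot.lift ⟨freeSemilift invSwapHom (swapGen a d x y),
    fun _ _ => freeSemilift_swapGen_rel hoff hsym hxy⟩

section

variable (hoff : ∀ i j, i ≠ j → a i j ≤ 0) (hsym : ∀ i j, d i * a i j = d j * a j i)
  {x y : Fin n → K2} (hxy : ∀ i, x i * y i = rr ^ d i * ss ^ d i)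

lemma swapHom_mk (u : FreeAlgebra K2 (Gen n)) :
    swapHom hoff hsym hxy (RingQuot.mkAlgHom K2 (URel a d) u) =
      freeSemilift invSwapHom (swapGen a d x y) u := by
  have : RingQuot.mkAlgHom K2 (URel a d) u = RingQuot.mkRingHom (URel a d) u :=
    DFunLike.congr_fun (RingQuot.mkAlgHom_coe K2 (URel a d)) u
  rw [this]
  exact RingQuot.lift_mkRingHom_apply _ _ _

lemma swapHom_gU (g : Gen n) : swapHom hoff hsym hxy (gU a d g) = swapGen a d x y g := by
  rw [gU, swapHom_mk, freeSemilift_ι]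

lemma swapHom_smul (c : K2) (z : Uq a d) :
    swapHom hoff hsym hxy (c • z) = invSwapHom c • swapHom hoff hsym hxy z := by
  refine map_smul_of_map_algebraMap (A := Uq a d) (B := Uq a d) (fun c => ?_) c z
  rw [← (RingQuot.mkAlgHom K2 (URel a d)).commutes, swapHom_mk, freeSemilift_algebraMap]

end

/-- A ring endomorphism of `U_{r,s}(𝔤)` that is linear and fixes the generators is the identity. -/
lemma ringHom_eq_id {F : Uq a d →+* Uq a d} (hF : ∀ (c : K2) (z : Uq a d), F (c • z) = c • F z)
    (hg : ∀ g : Gen n, F (gU a d g) = gU a d g) : F = RingHom.id _ := by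
  let G : Uq a d →ₐ[K2] Uq a d :=
    AlgHom.mk F fun c => by simp [Algebra.algebraMap_eq_smul_one, hF]
  have : G = AlgHom.id K2 _ :=
    RingQuot.ringQuot_ext' K2 _ _ (FreeAlgebra.hom_ext (funext hg))
  exact RingHom.ext fun z => DFunLike.congr_fun this z

lemma swapHom_comp_swapHom (hoff : ∀ i j, i ≠ j → a i j ≤ 0)
    (hsym : ∀ i j, d i * a i j = d j * a j i) {x y x' y' : Fin n → K2}
    (hxy : ∀ i, x i * y i = rr ^ d i * ss ^ d i) (hxy' : ∀ i, x' i * y' i = rr ^ d i * ss ^ d i)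
    (h₁ : ∀ i, invSwapHom (x' i) * y i = 1) (h₂ : ∀ i, invSwapHom (y' i) * x i = 1) :
    (swapHom hoff hsym hxy).comp (swapHom hoff hsym hxy') = RingHom.id _ := by
  refine ringHom_eq_id (fun c z => ?_) (fun g => ?_)
  · simp only [RingHom.comp_apply, swapHom_smul]
    rw [← RingHom.comp_apply, invSwapHom_comp_self, RingHom.id_apply]
  · rw [RingHom.comp_apply, swapHom_gU]
    cases g <;> simp [swapGen, swapHom_gU, swapHom_smul, smul_smul, h₁, h₂]

end QuantumGroup

/-- **Proposition 2.3 (Φ).** There is a ring automorphism `Φ` of `U_{r,s}(𝔤)`, semilinear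
over the field automorphism of `ℚ(r,s)` determined by `r ↦ s⁻¹`, `s ↦ r⁻¹`, with
`Φ(e_i) = f_i`, `Φ(f_i) = r_i s_i e_i`, `Φ(ω_i) = ω_i'` and `Φ(ω_i') = ω_i`. -/
theorem exists_Phi_automorphism
    (n : ℕ) (a : Fin n → Fin n → ℤ) (d : Fin n → ℤ)
    (hdiag : ∀ i, a i i = 2) (hoff : ∀ i j, i ≠ j → a i j ≤ 0)
    (hsym : ∀ i j, d i * a i j = d j * a j i) (hdpos : ∀ i, 0 < d i)
    (hfin : Matrix.PosDef (Matrix.of fun i j : Fin n => ((d i * a i j : ℤ) : ℝ))) :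
    ∃ (φ : K2 ≃+* K2) (Φ : Uq a d ≃+* Uq a d),
      φ rr = ss⁻¹ ∧ φ ss = rr⁻¹ ∧
      (∀ (c : K2) (x : Uq a d), Φ (c • x) = φ c • Φ x) ∧
      (∀ i, Φ (gU a d (Gen.e i)) = gU a d (Gen.f i)) ∧
      (∀ i, Φ (gU a d (Gen.f i)) = (rr ^ d i * ss ^ d i) • gU a d (Gen.e i)) ∧
      (∀ i, Φ (gU a d (Gen.w i)) = gU a d (Gen.w' i)) ∧
      (∀ i, Φ (gU a d (Gen.w' i)) = gU a d (Gen.w i)) := by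
  have hone (i : Fin n) : invSwapHom (rr ^ d i * ss ^ d i) * (rr ^ d i * ss ^ d i) = 1 := by
    have hr := zpow_ne_zero (d i) rr_ne_zero
    have hs := zpow_ne_zero (d i) ss_ne_zero
    simp only [map_mul, map_zpow₀, invSwapHom_rr, invSwapHom_ss, inv_zpow]
    field_simp
  have hxy (i : Fin n) : 1 * (rr ^ d i * ss ^ d i) = rr ^ d i * ss ^ d i := one_mul _
  have hxy' (i : Fin n) : (rr ^ d i * ss ^ d i) * 1 = rr ^ d i * ss ^ d i := mul_one _
  refine ⟨invSwap, RingEquiv.ofRingHom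
    (swapHom (x := fun _ => 1) (y := fun i => rr ^ d i * ss ^ d i) hoff hsym hxy)
    (swapHom (x := fun i => rr ^ d i * ss ^ d i) (y := fun _ => 1) hoff hsym hxy')
    (swapHom_comp_swapHom hoff hsym hxy hxy' hone (by simp))
    (swapHom_comp_swapHom hoff hsym hxy' hxy (by simp) hone),
    invSwapHom_rr, invSwapHom_ss, swapHom_smul hoff hsym hxy, fun i => ?_, fun i => ?_,
    fun i => ?_, fun i => ?_⟩
  · exact (swapHom_gU hoff hsym hxy _).trans (one_smul _ _)
  all_goals exact swapHom_gU hoff hsym hxy _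

end
end
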